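/- pv(Sym_7) = 2327/2520 and pv(A_7) = 1067/1260. -/

import Mathlib

open CategoryTheory

/-- An element `g` of a group is a *vanishing element* if some irreducible complex
character vanishes at `g`. -/
def IsVanishing {G : Type} [Group G] (g : G) : Prop :=
  ∃ V : FDRep ℂ G, Simple V ∧ V.character g = 0

/-- The proportion of vanishing elements of `G`. -/
noncomputable def pv (G : Type) [Group G] : ℝ :=
  (Set.ncard {g : G | IsVanishing g}) / (Nat.card G)

/-- The proportion of non-vanishing elements of `G`. -/
noncomputable def pnv (G : Type) [Group G] : ℝ :=
  (Set.ncard {g : G | ¬ IsVanishing g}) / (Nat.card G)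

section Representations

variable {G : Type}

/-- The sum of the operators `R x` over the conjugates `x` of `g`, running over the
conjugating elements. -/
@[irreducible]
noncomputable def conjSum [Group G] [Fintype G] {M : Type} [AddCommGroup M] [Module ℂ M]
    (R : G → Module.End ℂ M) (g : G) : Module.End ℂ M :=
  ∑ s : G, R (s * g * s⁻¹)

theorem conjSum_eq_card_smul [Group G] [Fintype G] {M : Type} [AddCommGroup M] [Module ℂ M] [DecidableEq G]
    (R : G → Module.End ℂ M) (x : G) {s : Finset G} (hs : ∀ g, g ∈ s ↔ IsConj x g) :
    conjSum R x = ((Finset.univ.filter fun t : G => t * x * t⁻¹ = x).card : ℂ) • ∑ g ∈ s, R g := by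
  rw [conjSum, ← Finset.sum_fiberwise_of_maps_to (t := s) (g := fun t => t * x * t⁻¹)
    (fun t _ => (hs _).2 (isConj_iff.2 ⟨t, rfl⟩)), Finset.smul_sum]
  refine Finset.sum_congr rfl fun g hg => ?_
  obtain ⟨t, rfl⟩ := isConj_iff.1 ((hs g).1 hg)
  rw [Finset.sum_congr rfl (g := fun _ => R (t * x * t⁻¹))
    (fun s hs => by rw [(Finset.mem_filter.1 hs).2]), Finset.sum_const, ← Nat.cast_smul_eq_nsmul ℂ]
  congr 2
  refine (Finset.card_equiv (Equiv.mulLeft t) fun s => ?_).symm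
  simp only [Finset.mem_filter, Finset.mem_univ, true_and, Equiv.coe_mulLeft]
  rw [show t * s * x * (t * s)⁻¹ = t * (s * x * s⁻¹) * t⁻¹ by group]
  simp

theorem mul_sum_smul_eq_sum_smul_mul [Group G] [Fintype G] {M : Type} [AddCommGroup M] [Module ℂ M] {φ : G → ℂ}
    (hφ : ∀ s g, φ (s * g * s⁻¹) = φ g) {R : G → Module.End ℂ M} {h : G} {A : Module.End ℂ M}
    (hA : ∀ g, A * R g = R (h * g * h⁻¹) * A) :
    A * ∑ g, φ g • R g = (∑ g, φ g • R g) * A := by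
  simp only [Finset.mul_sum, Finset.sum_mul, mul_smul_comm, smul_mul_assoc, hA]
  refine Fintype.sum_equiv (MulAut.conj h).toEquiv _ _ fun g => ?_
  simp [hφ]

theorem sum_smul_sum_smul [Fintype G] {ι M : Type} [AddCommGroup M] [Module ℂ M] (P : Finset ι) (a : ι → ℂ)
    (φ : ι → G → ℂ) (R : G → Module.End ℂ M) :
    ∑ p ∈ P, a p • ∑ g, φ p g • R g = ∑ g, (∑ p ∈ P, a p * φ p g) • R g := by
  simp only [Finset.smul_sum, smul_smul, Finset.sum_smul]
  exact Finset.sum_comm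

theorem sum_ite_smul [Fintype G] {M : Type} [AddCommGroup M] [Module ℂ M] (p : G → Prop) [DecidablePred p]
    (a : ℂ) (R : G → Module.End ℂ M) :
    ∑ g, (if p g then a else 0) • R g = a • ∑ g with p g, R g := by
  simp only [ite_smul, zero_smul, ← Finset.sum_filter, Finset.smul_sum]

theorem sum_smul_mul_left [Group G] [Fintype G] {M : Type} [AddCommGroup M] [Module ℂ M] (φ : G → ℂ)
    (R : G → Module.End ℂ M) (u t : G) :
    ∑ g, φ g • R (u * t * g) = ∑ g, φ (t⁻¹ * g) • R (u * g) :=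
  Fintype.sum_equiv (Equiv.mulLeft t) _ _ fun g => by simp [mul_assoc]

theorem mul_conjSum [Group G] [Fintype G] {M : Type} [AddCommGroup M] [Module ℂ M]
    (ρ : Representation ℂ G M) (g h : G) : ρ h * conjSum ρ g = conjSum ρ g * ρ h := by
  simp only [conjSum, Finset.mul_sum, Finset.sum_mul, ← map_mul]
  refine Fintype.sum_equiv (Equiv.mulLeft h) _ _ fun s => ?_
  simp [mul_assoc]

theorem trace_conjSum [Group G] [Fintype G] {M : Type} [AddCommGroup M] [Module ℂ M]
    (ρ : Representation ℂ G M) (g : G) :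
    LinearMap.trace ℂ M (conjSum ρ g) = Fintype.card G * ρ.character g := by
  have h : ∀ s : G, LinearMap.trace ℂ M (ρ (s * g * s⁻¹)) = ρ.character g :=
    fun s => ρ.char_conj g s
  simp only [conjSum, map_sum, h, Finset.sum_const, Finset.card_univ, nsmul_eq_mul]

theorem simple_of_isIrreducible [Group G] [Fintype G] {M : Type} [AddCommGroup M] [Module ℂ M]
    [FiniteDimensional ℂ M] (ρ : Representation ℂ G M) [ρ.IsIrreducible] :
    Simple (FDRep.of ρ) := by
  rw [FDRep.simple_iff_char_is_norm_one]
  have hG : (Nat.card G : ℂ) ≠ 0 := by simp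
  have := invertibleOfNonzero hG
  have h := Representation.char_orthonormal ρ ρ
  rw [if_pos ⟨Representation.Equiv.refl ρ⟩, inv_mul_eq_one₀ hG] at h
  exact h.symm

/-- If the class sum of `g` annihilates a nonzero vector of some finite-dimensional
representation, then `g` is a vanishing element. -/
theorem isVanishing_of_conjSum_apply_eq_zero [Group G] [Fintype G] {M : Type} [AddCommGroup M] [Module ℂ M]
    [FiniteDimensional ℂ M] (ρ : Representation ℂ G M) {g : G} {v : M} (hv : v ≠ 0)
    (h : conjSum ρ g v = 0) : IsVanishing g := by
  let S : Set (Submodule ℂ M) :=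
    {N | N ≠ ⊥ ∧ N ≤ LinearMap.ker (conjSum ρ g) ∧ ∀ x, ∀ w ∈ N, ρ x w ∈ N}
  have hS : S.Nonempty := by
    refine ⟨LinearMap.ker (conjSum ρ g), ?_, le_rfl, fun x w hw => ?_⟩
    · exact (Submodule.ne_bot_iff _).2 ⟨v, h, hv⟩
    · have := LinearMap.congr_fun (mul_conjSum ρ g x) w
      simp only [Module.End.mul_apply] at this
      rw [LinearMap.mem_ker] at hw ⊢
      rw [← this, hw, map_zero]
  obtain ⟨N, ⟨hN0, hNker, hNinv⟩, hmin⟩ := WellFounded.has_min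
    (wellFounded_lt (α := Submodule ℂ M)) S hS
  let σ : Subrepresentation ρ := ⟨N, fun x w hw => hNinv x w hw⟩
  let τ : Representation ℂ G N := σ.toRepresentation
  have : τ.IsIrreducible := by
    refine { exists_pair_ne := ⟨⊥, ⊤, fun hbt => hN0 ?_⟩, eq_bot_or_eq_top := fun U => ?_ }
    · have h1 : (⊥ : Submodule ℂ N) = ⊤ := congrArg Subrepresentation.toSubmodule hbt
      have h2 := congrArg (Submodule.map N.subtype) h1
      simpa using h2.symm
    · by_cases hU : U.toSubmodule = ⊥
      · exact Or.inl (Subrepresentation.toSubmodule_injective hU)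
      right
      apply Subrepresentation.toSubmodule_injective
      have hle : U.toSubmodule.map N.subtype ≤ N := Submodule.map_subtype_le N _
      have hmem : U.toSubmodule.map N.subtype ∈ S := by
        refine ⟨fun hb => hU ?_, hle.trans hNker, ?_⟩
        · exact Submodule.map_injective_of_injective N.injective_subtype
            (hb.trans (Submodule.map_bot _).symm)
        · rintro x _ ⟨w, hw, rfl⟩
          exact ⟨τ x w, U.apply_mem_toSubmodule x hw, rfl⟩
      have heq : U.toSubmodule.map N.subtype = N :=
        hle.eq_of_not_lt (hmin _ hmem)
      change U.toSubmodule = ⊤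
      apply Submodule.map_injective_of_injective N.injective_subtype
      rw [heq, Submodule.map_top, Submodule.range_subtype]
  refine ⟨FDRep.of τ, simple_of_isIrreducible τ, ?_⟩
  change τ.character g = 0
  have hz : conjSum τ g = 0 := by
    ext w
    have : ((conjSum τ g w : N) : M) = conjSum ρ g w := by
      simp only [conjSum, LinearMap.sum_apply, Submodule.coe_sum]
      rfl
    rw [this]
    simpa using hNker w.2
  have ht := trace_conjSum τ g
  rw [hz, map_zero] at ht
  simpa using ht.symm

theorem exists_eq_smul_one [Group G] (V : FDRep ℂ G) [Simple V] {A : Module.End ℂ V}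
    (hA : ∀ g, A * V.ρ g = V.ρ g * A) : ∃ c : ℂ, A = c • 1 := by
  let f : V ⟶ V :=
    { hom := FGModuleCat.ofHom A
      comm := fun x => by
        ext w
        exact LinearMap.congr_fun (hA x) w }
  obtain ⟨c, hc⟩ := endomorphism_simple_eq_smul_id ℂ f
  refine ⟨c, ?_⟩
  ext w
  have := congrArg (fun φ : V ⟶ V => φ.hom.hom.hom w) hc
  exact this.symm

theorem nontrivial_of_simple [Group G] (V : FDRep ℂ G) [Simple V] : Nontrivial V := by
  by_contra hn
  rw [not_nontrivial_iff_subsingleton] at hn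
  refine id_nonzero V ?_
  ext x
  exact Subsingleton.elim (α := V) _ _

/-- The class sum of an element acts as zero on the simple representations whose characters
vanish at that element. -/
theorem conjSum_eq_zero_of_character_eq_zero [Group G] [Fintype G] (V : FDRep ℂ G) [Simple V] {g : G}
    (hg : V.character g = 0) : conjSum V.ρ g = 0 := by
  have := nontrivial_of_simple V
  obtain ⟨c, hc⟩ := exists_eq_smul_one V (A := conjSum V.ρ g) fun x => (mul_conjSum V.ρ g x).symm
  have ht := trace_conjSum V.ρ g
  have hg' : Representation.character V.ρ g = 0 := hg
  rw [hg', hc, mul_zero, map_smul, LinearMap.trace_one, smul_eq_mul] at ht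
  have : (Module.finrank ℂ V : ℂ) ≠ 0 := by
    exact_mod_cast (Module.finrank_pos (R := ℂ) (M := V)).ne'
  rw [hc, (mul_eq_zero.1 ht).resolve_right this, zero_smul]

end Representations

section CharacterTable

open Equiv

/-- The number of fixed points of a permutation. -/
def fixCount (g : Perm (Fin 7)) : ℕ :=
  ((List.finRange 7).map fun i => bif decide (g i = i) then 1 else 0).sum

/-- The index of the conjugacy class of a permutation, read off from the numbers of fixed
points of its first three powers. -/
def classIndex (g : Perm (Fin 7)) : Fin 15 :=
  Fin.ofNat 15 ([777, 447, 373, 222, 131, 117, 43, 0, 575, 333, 245, 171, 111, 20, 3].idxOf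
    (100 * fixCount g + 10 * fixCount (g * g) + fixCount (g * g * g)))

/-- Representatives of the conjugacy classes. -/
def classRep (i : Fin 15) : Perm (Fin 7) :=
  [1, c[0, 1, 2], c[0, 1] * c[2, 3], c[0, 1, 2, 3, 4], c[0, 1, 2, 3] * c[4, 5],
    c[0, 1, 2] * c[3, 4, 5], c[0, 1, 2] * c[3, 4] * c[5, 6], c[0, 1, 2, 3, 4, 5, 6],
    c[0, 1], c[0, 1, 2, 3], c[0, 1, 2] * c[3, 4], c[0, 1] * c[2, 3] * c[4, 5],
    c[0, 1, 2, 3, 4, 5], c[0, 1, 2, 3, 4] * c[5, 6], c[0, 1, 2, 3] * c[4, 5, 6]].getD i 1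

/-- The orders of the centralizers. -/
def centralizerOrder (i : Fin 15) : ℤ :=
  [5040, 72, 48, 10, 8, 18, 24, 7, 240, 24, 12, 48, 6, 10, 12].getD i 0

/-- The characters of the symmetric group of degree `7`; the even classes come first, and
`Fin.rev` corresponds to the tensor product with the sign character. -/
def charTable (k i : Fin 15) : ℤ :=
  (if k < 8 ∨ i < 8 then 1 else -1) *
  ([[1, 1, 1, 1, 1, 1, 1, 1, 1, 1, 1, 1, 1, 1, 1],
    [6, 3, 2, 1, 0, 0, -1, -1, 4, 2, 1, 0, 0, -1, -1],
    [14, 2, 2, -1, 0, -1, 2, 0, 6, 0, 0, 2, -1, 1, 0],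
    [15, 3, -1, 0, -1, 0, -1, 1, 5, 1, -1, -3, 0, 0, 1],
    [14, -1, 2, -1, 0, 2, -1, 0, 4, -2, 1, 0, 0, -1, 1],
    [35, -1, -1, 0, 1, -1, -1, 0, 5, -1, -1, 1, 1, 0, -1],
    [21, -3, 1, 1, -1, 0, 1, 0, 1, -1, 1, -3, 0, 1, -1],
    [20, 2, -4, 0, 0, 2, 2, -1, 0, 0, 0, 0, 0, 0, 0]].getD (min k.val k.rev.val) []).getD i 0

/-- The eigenvalues of the sum of all `swap a b` with `a ≠ b`. -/
def swapEigenvalue (k : Fin 15) : ℤ :=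
  [42, 28, 18, 14, 12, 6, 2, 0, -2, -6, -12, -14, -18, -28, -42].getD k 0

theorem classIndex_classRep : ∀ i, classIndex (classRep i) = i := by
  decide +kernel

theorem sum_charTable_swap_mul_classRep : ∀ i k : Fin 15,
    ((List.finRange 7).map fun a => ((List.finRange 7).map fun b => bif decide (a = b) then 0 else
      charTable k (classIndex (swap a b * classRep i))).sum).sum =
        swapEigenvalue k * charTable k i := by
  decide +kernel

theorem sum_charTable_mul_charTable : ∀ i j : Fin 15,
    ∑ k, charTable k i * charTable k j = if i = j then centralizerOrder i else 0 := by
  decide +kernel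

theorem sign_classRep : ∀ i, Perm.sign (classRep i) = if i < 8 then 1 else -1 := by
  decide +kernel

theorem fixCount_conj (s g : Perm (Fin 7)) : fixCount (s * g * s⁻¹) = fixCount g := by
  simp only [fixCount, ← Fin.sum_univ_def]
  refine Fintype.sum_equiv s⁻¹ _ _ fun i => ?_
  simp [Perm.mul_apply, ← Perm.eq_inv_iff_eq]

theorem classIndex_conj (s g : Perm (Fin 7)) : classIndex (s * g * s⁻¹) = classIndex g := by
  have h2 : s * g * s⁻¹ * (s * g * s⁻¹) = s * (g * g) * s⁻¹ := by group
  have h3 : s * (g * g) * s⁻¹ * (s * g * s⁻¹) = s * (g * g * g) * s⁻¹ := by group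
  simp only [classIndex, h2, h3, fixCount_conj]

theorem classIndex_eq_of_isConj {g h : Perm (Fin 7)} (hgh : IsConj g h) :
    classIndex g = classIndex h := by
  obtain ⟨s, rfl⟩ := isConj_iff.1 hgh
  exact (classIndex_conj s g).symm

theorem cycleType_classRep : ∀ i, (classRep i).cycleType =
    [0, {3}, {2, 2}, {5}, {4, 2}, {3, 3}, {3, 2, 2}, {7}, {2}, {4}, {3, 2}, {2, 2, 2}, {6},
      {5, 2}, {4, 3}].getD i 0 := by
  decide +kernel

theorem exists_eq_of_sum_le_seven (m : Multiset ℕ) (h2 : ∀ n ∈ m, 2 ≤ n) (h7 : m.sum ≤ 7) :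
    ∃ i : Fin 15, m = [0, {3}, {2, 2}, {5}, {4, 2}, {3, 3}, {3, 2, 2}, {7}, {2}, {4}, {3, 2},
      {2, 2, 2}, {6}, {5, 2}, {4, 3}].getD i 0 := by
  induction m using Multiset.induction with
  | empty => exact ⟨0, rfl⟩
  | cons a m _ =>
    simp only [Multiset.mem_cons, forall_eq_or_imp, Multiset.sum_cons] at h2 h7
    obtain ⟨ha, h2⟩ := h2
    induction m using Multiset.induction with
    | empty =>
      have : a ≤ 7 := by simpa using h7
      interval_cases a <;> decide
    | cons b m _ =>
      simp only [Multiset.mem_cons, forall_eq_or_imp, Multiset.sum_cons] at h2 h7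
      obtain ⟨hb, h2⟩ := h2
      induction m using Multiset.induction with
      | empty =>
        have : a ≤ 5 := by omega
        have : b ≤ 5 := by omega
        simp only [Multiset.sum_zero] at h7
        interval_cases a <;> interval_cases b <;> first | omega | decide
      | cons c m _ =>
        simp only [Multiset.mem_cons, forall_eq_or_imp, Multiset.sum_cons] at h2 h7
        obtain ⟨hc, h2⟩ := h2
        induction m using Multiset.induction with
        | empty =>
          have : a ≤ 3 := by omega
          have : b ≤ 3 := by omega
          have : c ≤ 3 := by omega
          simp only [Multiset.sum_zero] at h7
          interval_cases a <;> interval_cases b <;> interval_cases c <;> first | omega | decide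
        | cons d m _ =>
          simp only [Multiset.mem_cons, forall_eq_or_imp, Multiset.sum_cons] at h2 h7
          omega

theorem isConj_classRep (g : Perm (Fin 7)) : IsConj g (classRep (classIndex g)) := by
  obtain ⟨i, hi⟩ := exists_eq_of_sum_le_seven g.cycleType
    (fun n hn => Perm.two_le_of_mem_cycleType hn)
    ((Perm.sum_cycleType_le g).trans (by simp))
  have h : IsConj g (classRep i) := by
    rw [Perm.isConj_iff_cycleType_eq, hi, cycleType_classRep]
  rwa [classIndex_eq_of_isConj h, classIndex_classRep]

theorem isConj_iff_classIndex_eq {g h : Perm (Fin 7)} :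
    IsConj g h ↔ classIndex g = classIndex h :=
  ⟨classIndex_eq_of_isConj, fun hgh =>
    (isConj_classRep g).trans (hgh ▸ (isConj_classRep h).symm)⟩

theorem sign_eq (g : Perm (Fin 7)) : Perm.sign g = if classIndex g < 8 then 1 else -1 := by
  obtain ⟨s, hs⟩ := isConj_iff.1 (isConj_classRep g)
  rw [← sign_classRep, ← hs, map_mul, map_mul, mul_right_comm, Perm.sign_inv,
    Int.units_mul_self, one_mul]

/-- The character number `k`, with complex values. -/
noncomputable def chi (k : Fin 15) (g : Perm (Fin 7)) : ℂ :=
  charTable k (classIndex g)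

theorem chi_conj (k : Fin 15) (s g : Perm (Fin 7)) : chi k (s * g * s⁻¹) = chi k g := by
  rw [chi, classIndex_conj, chi]

theorem sum_chi_swap_mul (k : Fin 15) (g : Perm (Fin 7)) :
    ∑ p ∈ (Finset.univ : Finset (Fin 7)).offDiag, chi k (swap p.1 p.2 * g) =
      swapEigenvalue k * chi k g := by
  obtain ⟨s, hs⟩ := isConj_iff.1 (isConj_classRep g).symm
  have key : ∑ a : Fin 7, ∑ b : Fin 7, (if a = b then 0 else
      charTable k (classIndex (swap a b * classRep (classIndex g)))) =
        swapEigenvalue k * charTable k (classIndex g) := by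
    rw [← sum_charTable_swap_mul_classRep]
    simp only [Fin.sum_univ_def, Bool.cond_decide]
  rw [chi, ← Int.cast_mul, ← key, ← Finset.sum_product', Finset.univ_product_univ]
  simp only [← ite_not (_ = _)]
  rw [← Finset.sum_filter, Int.cast_sum]
  refine Finset.sum_equiv (Equiv.prodCongr s⁻¹ s⁻¹) (by simp) fun p _ => ?_
  have : swap p.1 p.2 * g = s * (swap (s⁻¹ p.1) (s⁻¹ p.2) * classRep (classIndex g)) * s⁻¹ := by
    nth_rw 1 [← hs]
    rw [Equiv.swap_apply_apply]
    group
  rw [this, chi_conj]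
  rfl

theorem sum_chi_mul_chi (x g : Perm (Fin 7)) :
    ∑ k, chi k x * chi k g =
      if classIndex g = classIndex x then (centralizerOrder (classIndex x) : ℂ) else 0 := by
  have h := congrArg (Int.cast (R := ℂ))
    (sum_charTable_mul_charTable (classIndex x) (classIndex g))
  simp only [chi]
  push_cast at h
  simp only [h, eq_comm (a := classIndex x)]

theorem swapEigenvalue_injective : Function.Injective swapEigenvalue := by
  decide

theorem centralizerOrder_ne_zero : ∀ i, centralizerOrder i ≠ 0 := by
  decide

theorem eq_or_eq_rev_of_swapEigenvalue_sq : ∀ j k : Fin 15,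
    swapEigenvalue j ^ 2 = swapEigenvalue k ^ 2 → k = j ∨ k = j.rev := by
  decide +kernel

theorem charTable_rev : ∀ k i : Fin 15, i < 8 → charTable k.rev i = charTable k i := by
  decide +kernel

theorem lt_seven_of_charTable_ne_zero : ∀ i : Fin 15, (∀ k, charTable k i ≠ 0) → i < 7 := by
  decide +kernel

theorem card_classIndex_mul [Fintype (Perm (Fin 7))] (x : Perm (Fin 7)) :
    (Finset.univ.filter fun g : Perm (Fin 7) => classIndex g = classIndex x).card *
      centralizerOrder (classIndex x) = 5040 := by
  have h0 : ∀ k, ∑ g, chi k g = if k = 0 then 5040 else 0 := by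
    intro k
    split_ifs with hk
    · subst hk
      have : ∀ i, charTable 0 i = 1 := by decide +kernel
      simp only [chi, this, Int.cast_one, Finset.sum_const, Finset.card_univ]
      rw [← Nat.card_eq_fintype_card, Nat.card_perm, Nat.card_fin]
      norm_num [Nat.factorial]
    · have h : ∑ g, ∑ p ∈ (Finset.univ : Finset (Fin 7)).offDiag, chi k (swap p.1 p.2 * g) =
          swapEigenvalue k * ∑ g, chi k g := by
        simp only [sum_chi_swap_mul, Finset.mul_sum]
      rw [Finset.sum_comm] at h
      have h' : ∀ p ∈ (Finset.univ : Finset (Fin 7)).offDiag,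
          ∑ g, chi k (swap p.1 p.2 * g) = ∑ g, chi k g :=
        fun p _ => Fintype.sum_equiv (Equiv.mulLeft (swap p.1 p.2)) _ _ fun g => rfl
      rw [Finset.sum_congr rfl h', Finset.sum_const, Finset.offDiag_card] at h
      have hk' : swapEigenvalue k ≠ 42 := by
        have : ∀ k : Fin 15, k ≠ 0 → swapEigenvalue k ≠ 42 := by decide
        exact this k hk
      have hk'' : (42 - swapEigenvalue k : ℂ) ≠ 0 := by
        exact_mod_cast sub_ne_zero.2 hk'.symm
      refine (mul_eq_zero.1 ?_).resolve_left hk''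
      rw [sub_mul, ← h]
      simp
  have h1 : ∑ g, ∑ k, chi k x * chi k g = 5040 := by
    rw [Finset.sum_comm]
    simp only [← Finset.mul_sum, h0, mul_ite, mul_zero, Finset.sum_ite_eq', Finset.mem_univ,
      if_true]
    have : ∀ i, charTable 0 i = 1 := by decide +kernel
    simp [chi, this]
  simp only [sum_chi_mul_chi, ← Finset.sum_filter, Finset.sum_const, nsmul_eq_mul] at h1
  exact_mod_cast h1

section Projections

variable [Fintype (Perm (Fin 7))] {M : Type} [AddCommGroup M] [Module ℂ M]

/-- The sum of the operators `R g`, weighted with the character number `k`. -/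
@[irreducible]
noncomputable def charSum (R : Perm (Fin 7) → Module.End ℂ M) (k : Fin 15) : Module.End ℂ M :=
  ∑ g, chi k g • R g

theorem commute_charSum {R : Perm (Fin 7) → Module.End ℂ M} {h : Perm (Fin 7)}
    {A : Module.End ℂ M} (hA : ∀ g, A * R g = R (h * g * h⁻¹) * A) (k : Fin 15) :
    A * charSum R k = charSum R k * A := by
  rw [charSum]
  exact mul_sum_smul_eq_sum_smul_mul (chi_conj k) hA

theorem sum_chi_smul_charSum (R : Perm (Fin 7) → Module.End ℂ M) (x : Perm (Fin 7)) :
    ∃ c : ℂ, c ≠ 0 ∧ ∑ k, chi k x • charSum R k = c • conjSum R x := by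
  have h1 : ∑ k, chi k x • charSum R k =
      (centralizerOrder (classIndex x) : ℂ) • ∑ g with classIndex g = classIndex x, R g := by
    rw [← sum_ite_smul]
    simp only [charSum, ← sum_chi_mul_chi]
    exact sum_smul_sum_smul Finset.univ (fun k => chi k x) chi R
  have h2 := conjSum_eq_card_smul R x (s := {g | classIndex g = classIndex x})
    (fun g => by
      rw [Finset.mem_filter, isConj_iff_classIndex_eq]
      simp [eq_comm])
  have h3 : ((Finset.univ.filter fun t : Perm (Fin 7) => t * x * t⁻¹ = x).card : ℂ) ≠ 0 := by
    rw [Nat.cast_ne_zero, Finset.card_ne_zero]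
    exact ⟨1, by simp⟩
  refine ⟨centralizerOrder (classIndex x) /
    (Finset.univ.filter fun t : Perm (Fin 7) => t * x * t⁻¹ = x).card,
    div_ne_zero (by exact_mod_cast centralizerOrder_ne_zero _) h3, ?_⟩
  rw [h1, h2, smul_smul, div_mul_cancel₀ _ h3]

theorem sum_sum_chi_smul {R : Perm (Fin 7) → Module.End ℂ M} (k : Fin 15) (u : Perm (Fin 7)) :
    ∑ p ∈ (Finset.univ : Finset (Fin 7)).offDiag, ∑ g, chi k g • R (u * swap p.1 p.2 * g) =
      (swapEigenvalue k : ℂ) • ∑ g, chi k g • R (u * g) := by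
  simp only [sum_smul_mul_left, Equiv.swap_inv]
  have h := sum_smul_sum_smul (Finset.univ : Finset (Fin 7)).offDiag (fun _ => 1)
    (fun p g => chi k (swap p.1 p.2 * g)) fun g => R (u * g)
  have h' := sum_smul_sum_smul {k} (fun _ => (swapEigenvalue k : ℂ)) chi fun g => R (u * g)
  simp only [one_mul, one_smul, sum_chi_swap_mul, Finset.sum_singleton] at h h'
  rw [h, h']

theorem sum_sum_chi_smul_eq_charSum {R : Perm (Fin 7) → Module.End ℂ M} (k : Fin 15) :
    ∑ p ∈ (Finset.univ : Finset (Fin 7)).offDiag, ∑ g, chi k g • R (swap p.1 p.2 * g) =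
      (swapEigenvalue k : ℂ) • charSum R k := by
  rw [charSum]
  simpa only [one_mul] using sum_sum_chi_smul (R := R) k 1

/-- The class sum of `x` annihilates the eigenvectors of the sum of the transpositions
whose eigenvalue belongs to a character vanishing at `x`. -/
theorem conjSum_apply_eq_zero (ρ : Representation ℂ (Perm (Fin 7)) M) {x : Perm (Fin 7)} {v : M}
    {k : Fin 15}
    (hv : ∑ p ∈ (Finset.univ : Finset (Fin 7)).offDiag, ρ (swap p.1 p.2) v =
      (swapEigenvalue k : ℂ) • v) (hx : chi k x = 0) :
    conjSum ρ x v = 0 := by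
  have hE : ∀ j, j ≠ k → charSum ρ j v = 0 := by
    intro j hj
    set Q : Module.End ℂ M := ∑ p ∈ (Finset.univ : Finset (Fin 7)).offDiag, ρ (swap p.1 p.2)
      with hQ
    have h1 : Q * charSum ρ j = (swapEigenvalue j : ℂ) • charSum ρ j := by
      rw [← sum_sum_chi_smul_eq_charSum, hQ, Finset.sum_mul]
      simp only [charSum, Finset.mul_sum, map_mul, mul_smul_comm]
    have h2 : Q * charSum ρ j = charSum ρ j * Q := by
      rw [hQ, Finset.sum_mul, Finset.mul_sum]
      refine Finset.sum_congr rfl fun p _ => commute_charSum (h := swap p.1 p.2) (fun g => ?_) j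
      rw [← map_mul, ← map_mul, inv_mul_cancel_right]
    have h3 := LinearMap.congr_fun (h1.symm.trans h2) v
    have hQv : Q v = (swapEigenvalue k : ℂ) • v := by simpa [hQ] using hv
    rw [Module.End.mul_apply, hQv, map_smul, LinearMap.smul_apply, ← sub_eq_zero, ← sub_smul]
      at h3
    refine (smul_eq_zero.1 h3).resolve_left ?_
    refine sub_ne_zero.2 ?_
    exact_mod_cast swapEigenvalue_injective.ne hj
  obtain ⟨c, hc, h⟩ := sum_chi_smul_charSum ρ x
  have h' := LinearMap.congr_fun h v
  rw [LinearMap.sum_apply, LinearMap.smul_apply] at h'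
  refine (smul_eq_zero.1 (h'.symm.trans (Finset.sum_eq_zero fun j _ => ?_))).resolve_left hc
  rw [LinearMap.smul_apply]
  by_cases hj : j = k
  · rw [hj, hx, zero_smul]
  · rw [hE j hj, smul_zero]

theorem conjSum_ne_zero [Nontrivial M] {R : Perm (Fin 7) → Module.End ℂ M} (h1 : R 1 = 1)
    (hodd : ∀ g, Perm.sign g ≠ 1 → R g = 0)
    (hmul : ∀ g h, Perm.sign g = 1 → R (g * h) = R g * R h)
    (hscal : ∀ k, ∃ c : ℂ, charSum R k = c • 1) {x : Perm (Fin 7)} (hx : ∀ k, chi k x ≠ 0) :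
    conjSum R x ≠ 0 := by
  intro hsum
  choose c hc using hscal
  have hlin : ∀ a b : ℂ, a • (1 : Module.End ℂ M) = b • 1 → a = b :=
    fun a b hab => smul_left_injective ℂ (one_ne_zero (α := Module.End ℂ M)) hab
  obtain ⟨j, hj⟩ : ∃ j, c j ≠ 0 := by
    by_contra! h0
    obtain ⟨d, hd, h⟩ := sum_chi_smul_charSum R 1
    simp only [hc, h0, zero_smul, smul_zero, Finset.sum_const_zero] at h
    have hconj : conjSum R 1 = (Fintype.card (Perm (Fin 7)) : ℂ) • 1 := by
      rw [conjSum]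
      simp only [mul_one, mul_inv_cancel, h1, Finset.sum_const, Finset.card_univ]
      rw [Nat.cast_smul_eq_nsmul]
    rw [hconj, smul_smul] at h
    have := hlin 0 _ (by simpa using h)
    simp [hd, Fintype.card_ne_zero] at this
  set Y : Module.End ℂ M := ∑ q ∈ (Finset.univ : Finset (Fin 7)).offDiag,
    ∑ p ∈ (Finset.univ : Finset (Fin 7)).offDiag, R (swap q.1 q.2 * swap p.1 p.2) with hY
  have hYE : ∀ k, Y * charSum R k = ((swapEigenvalue k : ℂ) ^ 2) • charSum R k := by
    intro k
    have h2 : ∀ q ∈ (Finset.univ : Finset (Fin 7)).offDiag,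
        ∀ p ∈ (Finset.univ : Finset (Fin 7)).offDiag,
        R (swap q.1 q.2 * swap p.1 p.2) * charSum R k =
          ∑ g, chi k g • R (swap q.1 q.2 * swap p.1 p.2 * g) := by
      intro q hq p hp
      rw [charSum, Finset.mul_sum]
      refine Finset.sum_congr rfl fun g _ => ?_
      rw [mul_smul_comm, hmul (swap q.1 q.2 * swap p.1 p.2) g]
      rw [map_mul, Perm.sign_swap (Finset.mem_offDiag.1 hq).2.2,
        Perm.sign_swap (Finset.mem_offDiag.1 hp).2.2]
      rfl
    simp only [hY, Finset.sum_mul]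
    rw [Finset.sum_congr rfl fun q hq => (Finset.sum_congr rfl (h2 q hq)).trans
      (sum_sum_chi_smul k _), ← Finset.smul_sum, sum_sum_chi_smul_eq_charSum, smul_smul, ← sq]
  clear_value Y
  have hYc : ∀ k, c k ≠ 0 → Y = ((swapEigenvalue k : ℂ) ^ 2) • 1 := by
    intro k hk
    have := hYE k
    rw [hc, mul_smul_comm, mul_one, smul_comm] at this
    exact smul_right_injective _ hk this
  have hrev : charSum R j.rev = charSum R j := by
    simp only [charSum]
    refine Finset.sum_congr rfl fun g _ => ?_
    by_cases hg : Perm.sign g = 1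
    · rw [sign_eq] at hg
      have : classIndex g < 8 := by
        by_contra hlt
        rw [if_neg hlt] at hg
        exact absurd hg (by decide)
      rw [chi, charTable_rev _ _ this, chi]
    · rw [hodd g hg, smul_zero, smul_zero]
  have hx8 : classIndex x < 8 :=
    (lt_seven_of_charTable_ne_zero _ fun k hk => hx k (by simp [chi, hk])).trans (by decide)
  have hterm : ∀ k, chi k x * c k =
      if k = j ∨ k = j.rev then chi j x * c j else 0 := by
    intro k
    split_ifs with hk
    · rcases hk with rfl | rfl
      · rfl
      · rw [chi, charTable_rev _ _ hx8, chi, hlin (c j.rev) (c j) (by rw [← hc, ← hc, hrev])]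
    · rw [mul_eq_zero]
      right
      by_contra hck
      refine hk (eq_or_eq_rev_of_swapEigenvalue_sq j k ?_)
      have := hlin _ _ ((hYc j hj).symm.trans (hYc k hck))
      exact_mod_cast this
  obtain ⟨d, hd, h⟩ := sum_chi_smul_charSum R x
  rw [hsum, smul_zero] at h
  have hsmul : ∑ k, chi k x • charSum R k = (∑ k, chi k x * c k) • (1 : Module.End ℂ M) := by
    simp only [hc, smul_smul, Finset.sum_smul]
  rw [hsmul, Finset.sum_congr rfl fun k _ => hterm k, ← Finset.sum_filter, Finset.sum_const] at h
  have h' := (smul_eq_zero.1 h).resolve_right one_ne_zero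
  rw [nsmul_eq_mul, mul_eq_zero, Nat.cast_eq_zero, Finset.card_eq_zero] at h'
  rcases h' with h0 | h0
  · exact Finset.notMem_empty j (h0 ▸ by simp)
  · exact mul_ne_zero (hx j) hj h0

end Projections

theorem exists_commute_classRep : ∀ i : Fin 15, i < 7 →
    ∃ z ∈ [swap 0 1, swap 3 4, swap 5 6, swap 4 5, swap 0 3 * swap 1 4 * swap 2 5],
      Perm.sign z = -1 ∧ z * classRep i = classRep i * z := by
  decide +kernel

theorem exists_commute_of_classIndex_lt {x : Perm (Fin 7)} (hx : classIndex x < 7) :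
    ∃ z, Perm.sign z = -1 ∧ z * x = x * z := by
  obtain ⟨s, hs⟩ := isConj_iff.1 (isConj_classRep x).symm
  obtain ⟨z, -, hz, hzx⟩ := exists_commute_classRep _ hx
  refine ⟨s * z * s⁻¹, ?_, ?_⟩
  · rw [map_mul, map_mul, mul_right_comm, Perm.sign_inv, Int.units_mul_self, one_mul, hz]
  · rw [← hs]
    calc s * z * s⁻¹ * (s * classRep (classIndex x) * s⁻¹)
        = s * (z * classRep (classIndex x)) * s⁻¹ := by group
      _ = s * classRep (classIndex x) * s⁻¹ * (s * z * s⁻¹) := by rw [hzx]; group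

/-- The representation of a group on the functions on a set it acts on. -/
noncomputable def functionRep (G α : Type) [Group G] [MulAction G α] :
    Representation ℂ G (α → ℂ) where
  toFun s := LinearMap.funLeft ℂ ℂ (s⁻¹ • ·)
  map_one' := by ext; simp
  map_mul' s t := by
    refine LinearMap.ext fun v => funext fun a => ?_
    simp [LinearMap.funLeft_apply, mul_smul]

theorem functionRep_apply {G α : Type} [Group G] [MulAction G α] (s : G) (v : α → ℂ) (a : α) :
    functionRep G α s v a = v (s⁻¹ • a) :=
  rfl

/-- An eigenvector of the sum of the transpositions in the functions on pairs of points. -/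
def pairVector (p : Fin 7 × Fin 7) : ℤ :=
  if p = (0, 2) ∨ p = (1, 3) ∨ p = (2, 0) ∨ p = (3, 1) then 1
  else if p = (0, 3) ∨ p = (1, 2) ∨ p = (2, 1) ∨ p = (3, 0) then -1 else 0

theorem sum_pairVector_swap : ∀ c d : Fin 7,
    ∑ p ∈ (Finset.univ : Finset (Fin 7)).offDiag,
      pairVector (swap p.1 p.2 c, swap p.1 p.2 d) = 18 * pairVector (c, d) := by
  decide +kernel

theorem exists_odd_fixing (a b c d : Fin 7) : ∃ t : Perm (Fin 7), Perm.sign t = -1 ∧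
    t a = a ∧ t b = b ∧ t c = c ∧ t d = d := by
  have h4 : ({a, b, c, d} : Finset (Fin 7)).card ≤ 4 := Finset.card_le_four
  have h : 1 < ({a, b, c, d} : Finset (Fin 7))ᶜ.card := by
    rw [Finset.card_compl, Fintype.card_fin]
    omega
  obtain ⟨i, hi, j, hj, hij⟩ := Finset.one_lt_card.1 h
  simp only [Finset.mem_compl, Finset.mem_insert, Finset.mem_singleton, not_or] at hi hj
  refine ⟨swap i j, Perm.sign_swap hij, ?_, ?_, ?_, ?_⟩ <;>
    refine Equiv.swap_apply_of_ne_of_ne ?_ ?_ <;> grind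

section Restriction

variable [Fintype (Perm (Fin 7))] [Fintype (alternatingGroup (Fin 7))]

theorem sum_perm_eq_two_nsmul {N : Type} [AddCommMonoid N] {H : Perm (Fin 7) → N}
    (e : Perm (Fin 7) ≃ Perm (Fin 7)) (he : ∀ s, Perm.sign (e s) = -Perm.sign s)
    (hH : ∀ s, H (e s) = H s) :
    ∑ s, H s = 2 • ∑ s : alternatingGroup (Fin 7), H s := by
  have h1 : ∑ s : alternatingGroup (Fin 7), H s =
      ∑ s ∈ Finset.univ.filter (fun s : Perm (Fin 7) => Perm.sign s = 1), H s :=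
    (Finset.sum_subtype _ (by simp [Perm.mem_alternatingGroup]) _).symm
  rw [← Finset.sum_filter_add_sum_filter_not Finset.univ
    (fun s : Perm (Fin 7) => Perm.sign s = 1), h1, two_nsmul]
  congr 1
  refine Finset.sum_equiv e (fun s => ?_) fun s _ => (hH s).symm
  simp only [Finset.mem_filter, Finset.mem_univ, true_and, he]
  rcases Int.units_eq_one_or (Perm.sign s) with h | h <;> simp [h]

variable {M : Type} [AddCommGroup M] [Module ℂ M]

theorem conjSum_eq_two_nsmul (R : Perm (Fin 7) → Module.End ℂ M)
    {x : alternatingGroup (Fin 7)} {z : Perm (Fin 7)} (hz : Perm.sign z = -1)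
    (hzx : z * x = x * z) :
    conjSum R (x : Perm (Fin 7)) = 2 • conjSum (fun g : alternatingGroup (Fin 7) => R g) x := by
  simp only [conjSum]
  refine sum_perm_eq_two_nsmul (H := fun s => R (s * x * s⁻¹)) (Equiv.mulRight z)
    (fun s => by simp [hz]) fun s => ?_
  simp only [Equiv.coe_mulRight]
  rw [show s * z * (x : Perm (Fin 7)) * (s * z)⁻¹ = s * (z * x) * z⁻¹ * s⁻¹ by group, hzx,
    ← mul_assoc s, mul_inv_cancel_right]

theorem conjSum_functionRep_eq_two_nsmul (x : alternatingGroup (Fin 7))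
    (v : Fin 7 × Fin 7 → ℂ) :
    conjSum (functionRep (Perm (Fin 7)) (Fin 7 × Fin 7)) (x : Perm (Fin 7)) v =
      2 • conjSum (fun g : alternatingGroup (Fin 7) =>
        functionRep (Perm (Fin 7)) (Fin 7 × Fin 7) g) x v := by
  funext p
  have hexp : ∀ y : Perm (Fin 7), v (y • p) = ∑ q, if y • p = q then v q else 0 := by simp
  simp only [conjSum, LinearMap.sum_apply, Finset.sum_apply, Pi.smul_apply, functionRep_apply, hexp]
  rw [Finset.sum_comm, Finset.sum_comm (s := (Finset.univ : Finset (alternatingGroup (Fin 7)))),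
    Finset.smul_sum]
  refine Finset.sum_congr rfl fun q _ => ?_
  obtain ⟨t, ht, h1, h2, h3, h4⟩ := exists_odd_fixing p.1 p.2 q.1 q.2
  have hp : t⁻¹ • p = p := inv_smul_eq_iff.2 (Prod.ext h1.symm h2.symm)
  have hq : t⁻¹ • q = q := inv_smul_eq_iff.2 (Prod.ext h3.symm h4.symm)
  refine sum_perm_eq_two_nsmul
    (H := fun s => if (s * (x : Perm (Fin 7)) * s⁻¹)⁻¹ • p = q then v q else 0)
    (Equiv.mulLeft t) (fun s => by simp [ht]) fun s => ?_
  have : (t * s * (x : Perm (Fin 7)) * (t * s)⁻¹)⁻¹ • p =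
      t • (s * (x : Perm (Fin 7)) * s⁻¹)⁻¹ • t⁻¹ • p := by
    rw [show (t * s * (x : Perm (Fin 7)) * (t * s)⁻¹)⁻¹ =
      t * ((s * (x : Perm (Fin 7)) * s⁻¹)⁻¹ * t⁻¹) by group, mul_smul, mul_smul]
  simp only [Equiv.coe_mulLeft, this, hp, ← eq_inv_smul_iff (g := t), hq]

end Restriction

theorem chi_ne_zero (k : Fin 15) : chi k ≠ 0 := by
  have h : ∀ k, charTable k (classIndex 1) ≠ 0 := by decide +kernel
  intro hk
  have := congrFun hk 1
  simp [chi, h k] at this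

theorem sum_functionRep_chi (k : Fin 15) :
    ∑ p ∈ (Finset.univ : Finset (Fin 7)).offDiag,
      functionRep (Perm (Fin 7)) (Perm (Fin 7)) (swap p.1 p.2) (chi k) =
        (swapEigenvalue k : ℂ) • chi k := by
  funext g
  rw [Finset.sum_apply]
  simp only [functionRep_apply, Equiv.swap_inv, smul_eq_mul, sum_chi_swap_mul, Pi.smul_apply]

theorem sum_functionRep_pairVector :
    ∑ p ∈ (Finset.univ : Finset (Fin 7)).offDiag,
      functionRep (Perm (Fin 7)) (Fin 7 × Fin 7) (swap p.1 p.2) (fun q => (pairVector q : ℂ)) =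
        (swapEigenvalue 2 : ℂ) • fun q => (pairVector q : ℂ) := by
  funext q
  rw [Finset.sum_apply]
  have h := congrArg (Int.cast (R := ℂ)) (sum_pairVector_swap q.1 q.2)
  push_cast at h
  exact h

theorem isVanishing_perm_iff {x : Perm (Fin 7)} : IsVanishing x ↔ ∃ k, chi k x = 0 := by
  have : Fintype (Perm (Fin 7)) := Fintype.ofFinite _
  constructor
  · rintro ⟨V, hV, hχ⟩
    by_contra! hx
    have hsign : Perm.sign x = 1 := by
      rw [sign_eq, if_pos]
      exact (lt_seven_of_charTable_ne_zero _ fun k hk => hx k (by simp [chi, hk])).trans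
        (by decide)
    have := nontrivial_of_simple V
    let R : Perm (Fin 7) → Module.End ℂ V := fun g => if Perm.sign g = 1 then V.ρ g else 0
    refine conjSum_ne_zero (R := R) (by simp [R]) (fun g hg => if_neg hg)
      (fun g h hg => by simp [R, hg]) (fun k => exists_eq_smul_one V fun h => ?_) hx ?_
    · refine (commute_charSum (h := h) (fun g => ?_) k).symm
      by_cases hg : Perm.sign g = 1
      · have : Perm.sign (h * g * h⁻¹) = 1 := by simp [hg]
        simp only [R, if_pos hg, if_pos this, ← map_mul, inv_mul_cancel_right]
      · have : ¬ Perm.sign (h * g * h⁻¹) = 1 := by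
          rwa [map_mul, map_mul, mul_right_comm, Perm.sign_inv, Int.units_mul_self, one_mul]
        simp only [R, if_neg hg, if_neg this, mul_zero, zero_mul]
    · rw [← conjSum_eq_zero_of_character_eq_zero V hχ]
      simp only [conjSum]
      refine Finset.sum_congr rfl fun s _ => if_pos ?_
      simp [hsign]
  · rintro ⟨k, hk⟩
    exact isVanishing_of_conjSum_apply_eq_zero _ (chi_ne_zero k)
      (conjSum_apply_eq_zero _ (sum_functionRep_chi k) hk)

theorem isVanishing_alternating_iff {x : alternatingGroup (Fin 7)} :
    IsVanishing x ↔ ∃ k, chi k x = 0 := by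
  have : Fintype (Perm (Fin 7)) := Fintype.ofFinite _
  have : Fintype (alternatingGroup (Fin 7)) := Fintype.ofFinite _
  constructor
  · rintro ⟨V, hV, hχ⟩
    by_contra! hx
    obtain ⟨z, hz, hzx⟩ := exists_commute_of_classIndex_lt
      (lt_seven_of_charTable_ne_zero (classIndex x) fun k hk => hx k (by simp [chi, hk]))
    have := nontrivial_of_simple V
    let R : Perm (Fin 7) → Module.End ℂ V := fun g =>
      if hg : Perm.sign g = 1 then V.ρ ⟨g, Perm.mem_alternatingGroup.2 hg⟩ else 0
    have hR : ∀ g : alternatingGroup (Fin 7), R g = V.ρ g :=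
      fun g => dif_pos (Perm.mem_alternatingGroup.1 g.2)
    have hodd : ∀ g, Perm.sign g ≠ 1 → R g = 0 := fun g hg => dif_neg hg
    have hconj : ∀ h g : Perm (Fin 7), Perm.sign (h * g * h⁻¹) = Perm.sign g := fun h g => by
      rw [map_mul, map_mul, mul_right_comm, Perm.sign_inv, Int.units_mul_self, one_mul]
    refine conjSum_ne_zero (R := R) ((hR 1).trans (map_one _)) hodd
      (fun g h hg => ?_) (fun k => exists_eq_smul_one V fun h => ?_) hx ?_
    · by_cases hh : Perm.sign h = 1
      · lift g to alternatingGroup (Fin 7) using hg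
        lift h to alternatingGroup (Fin 7) using hh
        rw [← Subgroup.coe_mul, hR, hR, hR, map_mul]
      · rw [hodd h hh, hodd _ (by simpa [hg] using hh), mul_zero]
    · refine (commute_charSum (h := h) (fun g => ?_) k).symm
      by_cases hg : Perm.sign g = 1
      · lift g to alternatingGroup (Fin 7) using hg
        rw [← Subgroup.coe_mul, ← Subgroup.coe_inv, ← Subgroup.coe_mul, hR, hR, ← map_mul,
          ← map_mul, inv_mul_cancel_right]
      · rw [hodd g hg, hodd _ (by rwa [hconj]), mul_zero, zero_mul]
    · rw [conjSum_eq_two_nsmul R hz hzx, funext hR, conjSum_eq_zero_of_character_eq_zero V hχ,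
        smul_zero]
  · rintro ⟨k, hk⟩
    have htwo : ∀ {M : Type} [AddCommGroup M] [Module ℂ M] {w : M}, 2 • w = 0 → w = 0 :=
      fun {M} _ _ w hw => by
        rw [← Nat.cast_smul_eq_nsmul ℂ] at hw
        exact (smul_eq_zero.1 hw).resolve_left (by norm_num)
    by_cases h7 : classIndex (x : Perm (Fin 7)) < 7
    · obtain ⟨z, hz, hzx⟩ := exists_commute_of_classIndex_lt h7
      have h := conjSum_apply_eq_zero _ (sum_functionRep_chi k) hk
      rw [conjSum_eq_two_nsmul _ hz hzx] at h
      exact isVanishing_of_conjSum_apply_eq_zero ((functionRep (Perm (Fin 7)) (Perm (Fin 7))).comp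
        (alternatingGroup (Fin 7)).subtype) (chi_ne_zero k) (htwo h)
    · have hsign := sign_eq (x : Perm (Fin 7))
      rw [Perm.mem_alternatingGroup.1 x.2] at hsign
      have h8 : classIndex (x : Perm (Fin 7)) < 8 := by
        by_contra h8
        rw [if_neg h8] at hsign
        exact absurd hsign (by decide)
      have h7' : classIndex (x : Perm (Fin 7)) = 7 := by omega
      have hchi : chi 2 x = 0 := by
        rw [chi, h7']
        exact_mod_cast (by decide : charTable 2 7 = 0)
      have h := conjSum_apply_eq_zero _ sum_functionRep_pairVector hchi
      rw [conjSum_functionRep_eq_two_nsmul] at h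
      refine isVanishing_of_conjSum_apply_eq_zero
        ((functionRep (Perm (Fin 7)) (Fin 7 × Fin 7)).comp (alternatingGroup (Fin 7)).subtype)
        (fun h0 => ?_) (htwo h)
      have := congrFun h0 (0, 2)
      simp [pairVector] at this

theorem forall_chi_ne_zero_iff {x : Perm (Fin 7)} :
    (∀ k, chi k x ≠ 0) ↔ classIndex x ∈ ({0, 1, 2, 6} : Finset (Fin 15)) := by
  have h : ∀ i : Fin 15, (∀ k, charTable k i ≠ 0) ↔ i ∈ ({0, 1, 2, 6} : Finset (Fin 15)) := by
    decide +kernel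
  simp only [← h, chi, ne_eq, Int.cast_eq_zero]

theorem ncard_forall_chi_ne_zero : {x : Perm (Fin 7) | ∀ k, chi k x ≠ 0}.ncard = 386 := by
  have : Fintype (Perm (Fin 7)) := Fintype.ofFinite _
  have hcard : ∀ i : Fin 15,
      ((Finset.univ.filter fun g : Perm (Fin 7) => classIndex g = i).card : ℤ) =
        5040 / centralizerOrder i := by
    intro i
    have := card_classIndex_mul (classRep i)
    rw [classIndex_classRep] at this
    rw [← this, Int.mul_ediv_cancel _ (centralizerOrder_ne_zero i)]
  have hset : {x : Perm (Fin 7) | ∀ k, chi k x ≠ 0} =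
      (Finset.univ.filter fun x : Perm (Fin 7) => classIndex x ∈ ({0, 1, 2, 6} : Finset (Fin 15)) :
        Finset (Perm (Fin 7))) := by
    ext x
    simp [forall_chi_ne_zero_iff]
  have hmaps : ∀ x ∈ Finset.univ.filter (fun x : Perm (Fin 7) =>
      classIndex x ∈ ({0, 1, 2, 6} : Finset (Fin 15))),
      classIndex x ∈ ({0, 1, 2, 6} : Finset (Fin 15)) := fun x hx => (Finset.mem_filter.1 hx).2
  rw [hset, Set.ncard_coe_finset, Finset.card_eq_sum_card_fiberwise hmaps]
  zify
  rw [Finset.sum_congr rfl (g := fun i => 5040 / centralizerOrder i) fun i hi => ?_]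
  · decide
  · rw [Finset.filter_filter, ← hcard]
    congr 2
    ext x
    simp only [Finset.mem_filter, Finset.mem_univ, true_and, and_iff_right_iff_imp]
    rintro rfl
    exact hi

theorem ncard_alternating_forall_chi_ne_zero :
    {x : alternatingGroup (Fin 7) | ∀ k, chi k x ≠ 0}.ncard = 386 := by
  rw [← ncard_forall_chi_ne_zero, ← Set.ncard_image_of_injective _ Subtype.val_injective]
  congr 1
  ext x
  simp only [Set.mem_image, Set.mem_ofPred_eq]
  constructor
  · rintro ⟨y, hy, rfl⟩
    exact hy
  · intro hx
    refine ⟨⟨x, Perm.mem_alternatingGroup.2 ?_⟩, hx, rfl⟩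
    rw [sign_eq, if_pos]
    exact (lt_seven_of_charTable_ne_zero _ fun k hk => hx k (by simp [chi, hk])).trans
      (by decide)

end CharacterTable

theorem pv_eq {G : Type} [Group G] [Finite G] {p : G → Prop}
    (h : ∀ g : G, IsVanishing g ↔ ¬ p g) :
    pv G = (Nat.card G - {g | p g}.ncard : ℝ) / Nat.card G := by
  have : {g : G | IsVanishing g} = {g | p g}ᶜ := by
    ext g
    simp [h]
  rw [pv, this, Set.ncard_compl, Nat.cast_sub (Set.ncard_le_card _)]

theorem stmt12 :
    pv (Equiv.Perm (Fin 7)) = 2327 / 2520 ∧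
    pv (alternatingGroup (Fin 7)) = 1067 / 1260 := by
  have hS : Nat.card (Equiv.Perm (Fin 7)) = 5040 := by
    rw [Nat.card_perm, Nat.card_fin]
    rfl
  have hA : Nat.card (alternatingGroup (Fin 7)) = 2520 := by
    have := two_mul_nat_card_alternatingGroup (α := Fin 7)
    omega
  constructor
  · rw [pv_eq (p := fun x => ∀ k, chi k x ≠ 0) fun x => by simp [isVanishing_perm_iff],
      ncard_forall_chi_ne_zero, hS]
    norm_num
  · rw [pv_eq (p := fun x : alternatingGroup (Fin 7) => ∀ k, chi k x ≠ 0)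
      fun x => by simp [isVanishing_alternating_iff], ncard_alternating_forall_chi_ne_zero, hA]
    norm_num
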